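/- arXiv:0809.3286 — 6 statements merged into one kernel-verified Lean document; each statement's English description precedes it below -/
import Mathlib

section
/- Let F be a nontrivial finite group, d ≥ 2 an integer, and Γ = F ≀ ℤ^d the restricted wreath product, equipped with the word metric of some finite symmetric generating set. Then the fundamental class [Γ] vanishes in H_0^f(Γ) for f(t) = (1+t)^{1/d}: there exists an f-controlled 1-chain ψ on Γ with ∂ψ(x) = 1 for all x ∈ Γ. -/
/-- Word length of `γ` with respect to a generating set `S`. -/
noncomputable def wLen {Γ : Type*} [Group Γ] (S : Set Γ) (γ : Γ) : ℕ :=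
  sInf {n | ∃ l : List Γ, (∀ s ∈ l, s ∈ S) ∧ l.length = n ∧ l.prod = γ}

/-- The left-invariant word metric `d(x,y) = |x⁻¹y|`. -/
noncomputable def wDist {Γ : Type*} [Group Γ] (S : Set Γ) (x y : Γ) : ℕ :=
  wLen S (x⁻¹ * y)

/-- An `f`-controlled 1-chain on a group with the word metric of `S`. -/
structure IsChainW {Γ : Type*} [Group Γ] (S : Set Γ) (f : ℝ → ℝ) (ψ : Γ → Γ → ℝ) : Prop where
  antisymm : ∀ x y, ψ x y = - ψ y x
  finprop : ∃ R > (0:ℝ), ∀ x y, R < (wDist S x y : ℝ) → ψ x y = 0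
  bound : ∃ K > (0:ℝ), ∀ x y,
    |ψ x y| ≤ K * f (max (wLen S x : ℝ) (wLen S y : ℝ))

/-- The restricted direct product `⊕_{b ∈ B} A`: finitely supported functions
`B → A` under pointwise multiplication, as a subgroup of `B → A`. -/
def resProd (B A : Type*) [Group A] : Subgroup (B → A) where
  carrier := {f | (Function.mulSupport f).Finite}
  one_mem' := by
    simp [Function.mulSupport_one]
  mul_mem' := by
    intro f g hf hg
    exact Set.Finite.subset (hf.union hg) (Function.mulSupport_mul f g)
  inv_mem' := by
    intro f hf
    simpa [Function.mulSupport_inv] using hf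

/-- Translation of coordinates by `b ∈ B`, as an automorphism of `⊕_{b ∈ B} A`. -/
def translateEquiv (B A : Type*) [Group B] [Group A] (b : B) :
    resProd B A ≃* resProd B A where
  toFun f := ⟨fun x => (f : B → A) (b⁻¹ * x), by
    apply Set.Finite.subset ((f.2).image (fun x => b * x))
    intro x hx
    exact ⟨b⁻¹ * x, hx, by simp⟩⟩
  invFun f := ⟨fun x => (f : B → A) (b * x), by
    apply Set.Finite.subset ((f.2).image (fun x => b⁻¹ * x))
    intro x hx
    exact ⟨b * x, hx, by simp⟩⟩
  left_inv f := by
    apply Subtype.ext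
    funext x
    simp
  right_inv f := by
    apply Subtype.ext
    funext x
    simp
  map_mul' f g := rfl

/-- The translation action homomorphism `B →* Aut(⊕_{b ∈ B} A)`. -/
def translateHom (B A : Type*) [Group B] [Group A] :
    B →* MulAut (resProd B A) where
  toFun := translateEquiv B A
  map_one' := by
    refine MulEquiv.ext fun f => Subtype.ext (funext fun x => ?_)
    show (f : B → A) ((1:B)⁻¹ * x) = (f : B → A) x
    simp
  map_mul' := by
    intro b c
    refine MulEquiv.ext fun f => Subtype.ext (funext fun x => ?_)
    show (f : B → A) ((b * c)⁻¹ * x) = (f : B → A) (c⁻¹ * (b⁻¹ * x))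
    rw [mul_inv_rev, mul_assoc]

/-- The restricted wreath product `A ≀ B = (⊕_{b ∈ B} A) ⋊ B`. -/
abbrev WreathProd (A B : Type*) [Group A] [Group B] :=
  (resProd B A) ⋊[translateHom B A] B

/-- The probability that the Pólya urn process on the octant `ℕ^(D+1)` visits a given point
whose coordinates add up to `n`. -/
noncomputable def polyaProb (D n : ℕ) : ℝ := ((n + D).choose D : ℝ)⁻¹

theorem polyaProb_nonneg (D n : ℕ) : 0 ≤ polyaProb D n := by
  unfold polyaProb; positivity

theorem polyaProb_succ (D n : ℕ) :
    (n + 1 + D : ℝ) * polyaProb D (n + 1) = (n + 1) * polyaProb D n := by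
  have h := Nat.choose_mul_succ_eq (n + D) D
  have e : n + D + 1 - D = n + 1 := by omega
  rw [e, show n + D + 1 = n + 1 + D by omega] at h
  have h' : ((n + D).choose D : ℝ) * (n + 1 + D) = ((n + 1 + D).choose D : ℝ) * (n + 1) := by
    exact_mod_cast h
  have h1 : ((n + D).choose D : ℝ) ≠ 0 := by
    exact_mod_cast (Nat.choose_pos (Nat.le_add_left D n)).ne'
  have h2 : ((n + 1 + D).choose D : ℝ) ≠ 0 := by
    exact_mod_cast (Nat.choose_pos (Nat.le_add_left D (n + 1))).ne'
  unfold polyaProb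
  field_simp
  linarith

theorem pow_mul_polyaProb_le (D n : ℕ) :
    ((n : ℝ) + 1) ^ D * polyaProb D n ≤ D.factorial := by
  have h := Nat.pow_succ_le_ascFactorial (n + 1) D
  rw [Nat.ascFactorial_eq_factorial_mul_choose] at h
  have h' : ((n : ℝ) + 1) ^ D ≤ D.factorial * ((n + D).choose D : ℝ) := by exact_mod_cast h
  have h1 : (0 : ℝ) < ((n + D).choose D : ℝ) := by
    exact_mod_cast Nat.choose_pos (Nat.le_add_left D n)
  unfold polyaProb
  rwa [← div_eq_mul_inv, div_le_iff₀ h1]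

open Classical in
/-- The visiting probability `polyaProb` on the octant, extended by zero to `ℤ^(D+1)`. -/
noncomputable def polyaWeight (D : ℕ) (v : Fin (D + 1) → ℤ) : ℝ :=
  if 0 ≤ v then polyaProb D (∑ j, v j).toNat else 0

theorem polyaWeight_nonneg (D : ℕ) (v : Fin (D + 1) → ℤ) : 0 ≤ polyaWeight D v := by
  unfold polyaWeight
  split_ifs
  · exact polyaProb_nonneg _ _
  · exact le_rfl

/-- The flow of the Pólya urn process, started at the origin, along the edge from `v` to
`v + e_i`. -/
noncomputable def polyaFlow (D : ℕ) (i : Fin (D + 1)) (v : Fin (D + 1) → ℤ) : ℝ :=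
  (v i + 1) / (∑ j, v j + D + 1) * polyaWeight D v

theorem abs_polyaFlow_le (D : ℕ) (i : Fin (D + 1)) (v : Fin (D + 1) → ℤ) :
    |polyaFlow D i v| ≤ polyaWeight D v := by
  by_cases hv : 0 ≤ v
  · have h0 : ∀ j, (0 : ℝ) ≤ v j := fun j => by exact_mod_cast hv j
    have h1 : (v i : ℝ) ≤ ∑ j, (v j : ℝ) :=
      Finset.single_le_sum (fun j _ => h0 j) (Finset.mem_univ i)
    have hD : (0 : ℝ) ≤ D := Nat.cast_nonneg D
    have h2 := h0 i
    unfold polyaFlow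
    rw [abs_mul, abs_of_nonneg (polyaWeight_nonneg D v)]
    refine mul_le_of_le_one_left (polyaWeight_nonneg D v) ?_
    push_cast
    have h3 : (0 : ℝ) < ∑ j, (v j : ℝ) + D + 1 := by linarith
    rw [abs_of_nonneg (div_nonneg (by linarith) h3.le), div_le_one h3]
    linarith
  · simp [polyaFlow, polyaWeight, hv]

theorem polyaFlow_sub_single (D : ℕ) (i : Fin (D + 1)) {v : Fin (D + 1) → ℤ} (hv : 0 ≤ v)
    {n : ℕ} (hn : ∑ j, v j = n + 1) :
    polyaFlow D i (v - Pi.single i 1) = v i / (n + D + 1) * polyaProb D n := by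
  have hs : ∑ j, (v - Pi.single i 1 : Fin (D + 1) → ℤ) j = n := by
    simp [Finset.sum_sub_distrib, hn, Finset.sum_pi_single']
  have hsi : (v - Pi.single i 1 : Fin (D + 1) → ℤ) i = v i - 1 := by simp
  unfold polyaFlow
  have hs' : (∑ j, (((v - Pi.single i 1 : Fin (D + 1) → ℤ) j : ℤ) : ℝ)) = n := by exact_mod_cast hs
  by_cases h : 0 ≤ v - Pi.single i 1
  · rw [polyaWeight, if_pos h, hs, hsi]
    push_cast
    simp
  · have hvi : v i = 0 := by
      by_contra hne
      refine h fun j => ?_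
      by_cases hj : j = i
      · subst hj
        have := hv j
        simp only [Pi.zero_apply, Pi.sub_apply, Pi.single_eq_same] at *
        omega
      · simpa [hj] using hv j
    simp [polyaWeight, h, hvi]

theorem sum_polyaFlow_sub (D : ℕ) (v : Fin (D + 1) → ℤ) :
    ∑ i, (polyaFlow D i v - polyaFlow D i (v - Pi.single i 1)) = if v = 0 then 1 else 0 := by
  by_cases hv : 0 ≤ v
  · have hout : ∑ i, polyaFlow D i v = polyaWeight D v := by
      have h0 : (0 : ℝ) ≤ ∑ j, (v j : ℝ) :=
        Finset.sum_nonneg fun j _ => by exact_mod_cast hv j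
      unfold polyaFlow
      rw [← Finset.sum_mul, ← Finset.sum_div, Finset.sum_add_distrib]
      simp only [Finset.sum_const, Finset.card_univ, Fintype.card_fin, nsmul_eq_mul, mul_one]
      push_cast
      rw [add_assoc, div_self (by positivity), one_mul]
    rw [Finset.sum_sub_distrib, hout]
    by_cases h : v = 0
    · subst h
      have : ∀ i : Fin (D + 1), polyaFlow D i (-Pi.single i 1) = 0 := fun i => by
        simp [polyaFlow]
      simp [this, polyaWeight, polyaProb]
    · obtain ⟨k, hk⟩ : ∃ k, v k ≠ 0 := Function.ne_iff.mp h
      have hpos : 0 < ∑ j, v j :=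
        Finset.sum_pos' (fun j _ => hv j) ⟨k, Finset.mem_univ k, lt_of_le_of_ne (hv k) hk.symm⟩
      obtain ⟨n, hn⟩ : ∃ n : ℕ, ∑ j, v j = n + 1 := ⟨(∑ j, v j - 1).toNat, by omega⟩
      have hn' : ∑ j, (v j : ℝ) = n + 1 := by exact_mod_cast hn
      simp only [polyaFlow_sub_single D _ hv hn]
      rw [← Finset.sum_mul, ← Finset.sum_div, hn', polyaWeight, if_pos hv, if_neg h, hn,
        show ((n : ℤ) + 1).toNat = n + 1 by omega]
      have hs := polyaProb_succ D n
      have hp : (n + D + 1 : ℝ) ≠ 0 := by positivity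
      field_simp
      linarith
  · have hne : v ≠ 0 := fun h => hv h.ge
    have h1 : ∀ i, ¬ 0 ≤ v - Pi.single i 1 := fun i h =>
      hv (h.trans (sub_le_self _ (Pi.single_nonneg.mpr zero_le_one)))
    simp [polyaFlow, polyaWeight, hv, h1, hne]

theorem card_le_of_sum_eq (D n : ℕ) (U : Finset (Fin (D + 1) → ℤ))
    (h0 : ∀ u ∈ U, 0 ≤ u) (hn : ∀ u ∈ U, ∑ j, u j = n) : U.card ≤ (n + 1) ^ D := by
  have hcard : (Fintype.piFinset fun _ : Fin D => Finset.Icc (0 : ℤ) n).card = (n + 1) ^ D := by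
    simp
  rw [← hcard]
  refine Finset.card_le_card_of_injOn (fun u j => u j.succ) ?_ ?_
  · intro u hu
    have hu' : u ∈ U := hu
    simp only [Finset.mem_coe, Fintype.mem_piFinset, Finset.mem_Icc]
    refine fun j => ⟨h0 u hu' _, ?_⟩
    rw [← hn u hu']
    exact Finset.single_le_sum (fun k _ => h0 u hu' k) (Finset.mem_univ j.succ)
  · intro u hu w hw huw
    have hs := (hn u hu).trans (hn w hw).symm
    have hj : ∀ j : Fin D, u j.succ = w j.succ := fun j => congrFun huw j
    rw [Fin.sum_univ_succ, Fin.sum_univ_succ, Finset.sum_congr rfl fun j _ => hj j] at hs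
    funext k
    refine Fin.cases ?_ hj k
    linarith

theorem sum_polyaWeight_le_of_lt (D r : ℕ) (U : Finset (Fin (D + 1) → ℤ))
    (h0 : ∀ u ∈ U, 0 ≤ u) (hr : ∀ u ∈ U, (∑ j, u j).toNat < r) :
    ∑ u ∈ U, polyaWeight D u ≤ r * D.factorial := by
  rw [← Finset.sum_fiberwise_of_maps_to (t := Finset.range r)
    (g := fun u => (∑ j, u j).toNat) fun u hu => Finset.mem_range.mpr (hr u hu)]
  refine (Finset.sum_le_card_nsmul _ _ (D.factorial : ℝ) fun n _ => ?_).trans_eq (by simp)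
  have hc : ∀ u ∈ U.filter (fun u => (∑ j, u j).toNat = n), polyaWeight D u = polyaProb D n :=
    fun u hu => by
      rw [Finset.mem_filter] at hu
      rw [polyaWeight, if_pos (h0 u hu.1), hu.2]
  rw [Finset.sum_congr rfl hc, Finset.sum_const, nsmul_eq_mul]
  refine le_trans ?_ (pow_mul_polyaProb_le D n)
  refine mul_le_mul_of_nonneg_right ?_ (polyaProb_nonneg D n)
  have := card_le_of_sum_eq D n (U.filter fun u => (∑ j, u j).toNat = n)
    (fun u hu => h0 u (Finset.mem_filter.mp hu).1) fun u hu => by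
      have h1 := Finset.mem_filter.mp hu
      have h2 : 0 ≤ ∑ j, u j := Finset.sum_nonneg fun j _ => h0 u h1.1 j
      omega
  exact_mod_cast this

/-- The decay of the Pólya flow makes its sum over `m` translates `O(m^(1/(D+1)))`. -/
theorem sum_polyaWeight_le (D : ℕ) (U : Finset (Fin (D + 1) → ℤ)) :
    ∑ u ∈ U, polyaWeight D u ≤ 3 * D.factorial * (U.card : ℝ) ^ (((D + 1 : ℕ) : ℝ)⁻¹) := by
  classical
  rcases U.eq_empty_or_nonempty with rfl | hU
  · simp only [Finset.sum_empty]; positivity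
  have hcard : (1 : ℝ) ≤ U.card := by exact_mod_cast hU.card_pos
  set ρ : ℝ := (U.card : ℝ) ^ (((D + 1 : ℕ) : ℝ)⁻¹) with hρ
  have hρ1 : 1 ≤ ρ := Real.one_le_rpow hcard (by positivity)
  have hρpow : ρ ^ (D + 1) = U.card :=
    Real.rpow_inv_natCast_pow (by positivity) D.succ_ne_zero
  set r := ⌈ρ⌉₊
  have hr1 : ρ ≤ r := Nat.le_ceil ρ
  have hr2 : (r : ℝ) ≤ 2 * ρ := by linarith [Nat.ceil_lt_add_one (zero_le_one.trans hρ1)]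
  rw [← Finset.sum_filter_add_sum_filter_not U fun u => 0 ≤ u ∧ (∑ j, u j).toNat < r]
  have hnear := sum_polyaWeight_le_of_lt D r
    (U.filter fun u => 0 ≤ u ∧ (∑ j, u j).toNat < r)
    (fun u hu => (Finset.mem_filter.mp hu).2.1) (fun u hu => (Finset.mem_filter.mp hu).2.2)
  have hfar : ∑ u ∈ U with ¬ (0 ≤ u ∧ (∑ j, u j).toNat < r), polyaWeight D u
      ≤ D.factorial * ρ := by
    have hterm : ∀ u ∈ U.filter (fun u => ¬ (0 ≤ u ∧ (∑ j, u j).toNat < r)),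
        polyaWeight D u ≤ D.factorial / ρ ^ D := fun u hu => by
      have hu' := (Finset.mem_filter.mp hu).2
      by_cases h0 : 0 ≤ u
      · have hle : r ≤ (∑ j, u j).toNat := not_lt.mp fun h => hu' ⟨h0, h⟩
        have hle' : ρ ≤ ((∑ j, u j).toNat : ℝ) + 1 := by
          have : (r : ℝ) ≤ ((∑ j, u j).toNat : ℝ) := by exact_mod_cast hle
          linarith
        rw [polyaWeight, if_pos h0, le_div_iff₀ (by positivity), mul_comm]
        refine le_trans ?_ (pow_mul_polyaProb_le D (∑ j, u j).toNat)
        have := polyaProb_nonneg D (∑ j, u j).toNat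
        gcongr
      · rw [polyaWeight, if_neg h0]
        positivity
    refine (Finset.sum_le_card_nsmul _ _ _ hterm).trans ?_
    rw [nsmul_eq_mul]
    calc _ ≤ (U.card : ℝ) * (D.factorial / ρ ^ D) := by
            gcongr
            exact Finset.filter_subset _ _
      _ = D.factorial * ρ := by
            rw [← hρpow]
            field_simp
            ring
  have : (r : ℝ) * D.factorial ≤ 2 * ρ * D.factorial := by gcongr
  linarith

section WordLength

variable {Γ : Type*} [Group Γ]

theorem exists_list_length_eq_wLen {S : Set Γ} (hsym : ∀ s ∈ S, s⁻¹ ∈ S)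
    (hgen : Subgroup.closure S = ⊤) (x : Γ) :
    ∃ l : List Γ, (∀ s ∈ l, s ∈ S) ∧ l.length = wLen S x ∧ l.prod = x := by
  have hx : x ∈ Submonoid.closure S := by
    have hinv : S⁻¹ ⊆ S := fun s hs => by simpa using hsym _ hs
    rw [← Set.union_eq_self_of_subset_right hinv, ← Subgroup.closure_toSubmonoid, hgen]
    exact Subgroup.mem_top x
  obtain ⟨l, hl, hprod⟩ := Submonoid.exists_list_of_mem_closure hx
  exact Nat.sInf_mem (s := {n | ∃ l : List Γ, (∀ s ∈ l, s ∈ S) ∧ l.length = n ∧ l.prod = x})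
    ⟨l.length, l, hl, rfl, hprod⟩

open Classical in
/-- The antisymmetric chain carrying the amount `q i x` along each edge from `x` to
`x * σ i`. -/
noncomputable def edgeChain {ι : Type*} [Fintype ι] (σ : ι → Γ) (q : ι → Γ → ℝ) (x y : Γ) : ℝ :=
  ∑ i, ((if y = x * σ i then q i x else 0) - (if x = y * σ i then q i y else 0))

variable {ι : Type*} [Fintype ι] (σ : ι → Γ) (q : ι → Γ → ℝ)

theorem finsum_edgeChain (x : Γ) :
    ∑ᶠ y, edgeChain σ q y x = ∑ i, (q i (x * (σ i)⁻¹) - q i x) := by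
  classical
  unfold edgeChain
  have h1 : ∀ i, (fun y => if x = y * σ i then q i y else 0) =
      fun y => if y = x * (σ i)⁻¹ then q i (x * (σ i)⁻¹) else 0 := fun i => by
    funext y
    by_cases h : y = x * (σ i)⁻¹
    · simp [h]
    · have h' : ¬ x = y * σ i := fun h' => h (by simp [h'])
      simp [h, h']
  have hfin : ∀ (a : Γ) (c : ℝ), (Function.support fun y => if y = a then c else 0).Finite :=
    fun a c => (Set.finite_singleton a).subset fun y hy => by
      by_contra hne
      exact hy (if_neg hne)
  have hsum : ∀ (a : Γ) (c : ℝ), ∑ᶠ y, (if y = a then c else 0) = c := fun a c => by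
    rw [finsum_eq_single _ a fun y hy => if_neg hy, if_pos rfl]
  have hfin1 : ∀ i, (Function.support fun y => if x = y * σ i then q i y else 0).Finite :=
    fun i => by rw [h1 i]; exact hfin _ _
  rw [finsum_sum_comm _ _ fun i _ =>
    ((hfin1 i).union (hfin (x * σ i) (q i x))).subset (Function.support_sub _ _)]
  refine Finset.sum_congr rfl fun i _ => ?_
  rw [finsum_sub_distrib (hfin1 i) (hfin _ _), hsum, h1 i, hsum]

theorem isChainW_edgeChain (S : Set Γ) {f : ℝ → ℝ} (hf : MonotoneOn f (Set.Ici 0)) {K : ℝ}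
    (hK : ∀ i x, |q i x| ≤ K * f (wLen S x)) (hK0 : 0 ≤ K) (hf0 : 0 ≤ f 0) :
    IsChainW S f (edgeChain σ q) where
  antisymm x y := by
    simp [edgeChain]
  finprop := by
    refine ⟨∑ i, ((wLen S (σ i) : ℝ) + wLen S (σ i)⁻¹) + 1, by positivity, fun x y hxy => ?_⟩
    have hle : ∀ i, (wLen S (σ i) : ℝ) + wLen S (σ i)⁻¹ ≤
        ∑ i, ((wLen S (σ i) : ℝ) + wLen S (σ i)⁻¹) := fun i =>
      Finset.single_le_sum (f := fun i => (wLen S (σ i) : ℝ) + wLen S (σ i)⁻¹)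
        (fun _ _ => by positivity) (Finset.mem_univ i)
    refine Finset.sum_eq_zero fun i _ => ?_
    have hi := hle i
    have p1 : (0 : ℝ) ≤ wLen S (σ i) := Nat.cast_nonneg _
    have p2 : (0 : ℝ) ≤ wLen S (σ i)⁻¹ := Nat.cast_nonneg _
    rw [if_neg, if_neg, sub_zero]
    · rintro rfl
      rw [wDist, mul_inv_rev, inv_mul_cancel_right] at hxy
      linarith
    · rintro rfl
      rw [wDist, inv_mul_cancel_left] at hxy
      linarith
  bound := by
    classical
    refine ⟨2 * Fintype.card ι * K + 1, by positivity, fun x y => ?_⟩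
    set m := max (wLen S x : ℝ) (wLen S y : ℝ)
    have hm0 : 0 ≤ m := le_max_of_le_left (Nat.cast_nonneg _)
    have hfm : 0 ≤ f m := hf0.trans (hf Set.self_mem_Ici hm0 hm0)
    have hx : ∀ i, |q i x| ≤ K * f m := fun i => (hK i x).trans <|
      mul_le_mul_of_nonneg_left (hf (Nat.cast_nonneg _ : (0:ℝ) ≤ _) hm0 (le_max_left _ _)) hK0
    have hy : ∀ i, |q i y| ≤ K * f m := fun i => (hK i y).trans <|
      mul_le_mul_of_nonneg_left (hf (Nat.cast_nonneg _ : (0:ℝ) ≤ _) hm0 (le_max_right _ _)) hK0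
    have hite : ∀ (p : Prop) [Decidable p] (a : ℝ), |a| ≤ K * f m →
        |if p then a else 0| ≤ K * f m := fun p _ a ha => by
      split_ifs
      · exact ha
      · simpa using mul_nonneg hK0 hfm
    calc |edgeChain σ q x y| ≤ ∑ _i : ι, (K * f m + K * f m) :=
          (Finset.abs_sum_le_sum_abs _ _).trans <| Finset.sum_le_sum fun i _ =>
            (abs_sub _ _).trans (add_le_add (hite _ _ (hx i)) (hite _ _ (hy i)))
      _ = 2 * Fintype.card ι * K * f m := by
          rw [Finset.sum_const, Finset.card_univ, nsmul_eq_mul]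
          ring
      _ ≤ _ := by
          rw [add_mul]
          linarith

end WordLength

section Lamplighter

variable {A B : Type*} [Group A] [Group B]

/-- The finite set of lit lamps of an element of `A ≀ B`. -/
noncomputable def lampSupport (x : WreathProd A B) : Finset B :=
  Set.Finite.toFinset (s := Function.mulSupport (x.left : B → A)) x.left.2

theorem mem_lampSupport {x : WreathProd A B} {b : B} :
    b ∈ lampSupport x ↔ (x.left : B → A) b ≠ 1 := by
  exact Set.Finite.mem_toFinset _

theorem left_mul_apply (x y : WreathProd A B) (b : B) :
    ((x * y).left : B → A) b = (x.left : B → A) b * (y.left : B → A) (x.right⁻¹ * b) := rfl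

theorem card_lampSupport_mul_le (x y : WreathProd A B) :
    (lampSupport (x * y)).card ≤ (lampSupport x).card + (lampSupport y).card := by
  classical
  have hsub : lampSupport (x * y) ⊆ lampSupport x ∪ (lampSupport y).image (x.right * ·) := by
    intro b hb
    rw [mem_lampSupport, left_mul_apply] at hb
    rw [Finset.mem_union, Finset.mem_image, mem_lampSupport]
    by_contra! h
    refine hb ?_
    rw [h.1, one_mul]
    by_contra hne
    exact h.2 _ (mem_lampSupport.mpr hne) (mul_inv_cancel_left _ _)
  exact (Finset.card_le_card hsub).trans <| (Finset.card_union_le _ _).trans <|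
    Nat.add_le_add_left Finset.card_image_le _

theorem card_lampSupport_list_prod_le {M : ℕ} (l : List (WreathProd A B))
    (hl : ∀ s ∈ l, (lampSupport s).card ≤ M) : (lampSupport l.prod).card ≤ l.length * M := by
  induction l with
  | nil =>
    have : lampSupport (1 : WreathProd A B) = ∅ :=
      Finset.eq_empty_of_forall_notMem fun b hb => mem_lampSupport.mp hb rfl
    simp [this]
  | cons s l ih =>
    rw [List.prod_cons, List.length_cons, add_mul, one_mul, add_comm]
    exact (card_lampSupport_mul_le s l.prod).trans <| add_le_add
      (hl s List.mem_cons_self) (ih fun t ht => hl t (List.mem_cons_of_mem s ht))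

theorem exists_card_lampSupport_le (S : Finset (WreathProd A B)) (hsym : ∀ s ∈ S, s⁻¹ ∈ S)
    (hgen : Subgroup.closure (S : Set (WreathProd A B)) = ⊤) :
    ∃ M : ℕ, ∀ x, (lampSupport x).card ≤ M * wLen (S : Set (WreathProd A B)) x := by
  refine ⟨S.sup fun s => (lampSupport s).card, fun x => ?_⟩
  obtain ⟨l, hl, hlen, hprod⟩ := exists_list_length_eq_wLen
    (S := (S : Set (WreathProd A B))) hsym hgen x
  have h := card_lampSupport_list_prod_le l
    fun s hs => Finset.le_sup (f := fun s => (lampSupport s).card) (hl s hs)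
  rwa [hprod, hlen, mul_comm] at h

open Classical in
/-- The element of `A ≀ B` that multiplies the lamp at the cursor by `a`. -/
noncomputable def lampSwitch (B : Type*) [Group B] (a : A) : WreathProd A B :=
  SemidirectProduct.inl ⟨Pi.mulSingle 1 a,
    (Set.finite_singleton 1).subset Pi.mulSupport_mulSingle_subset⟩

theorem mul_lampSwitch_inv_right (x : WreathProd A B) (a : A) :
    (x * (lampSwitch B a)⁻¹).right = x.right := by
  simp [lampSwitch]

theorem mul_lampSwitch_inv_left (x : WreathProd A B) (a : A) :
    ((x * (lampSwitch B a)⁻¹).left : B → A) x.right = (x.left : B → A) x.right * a⁻¹ := by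
  classical
  have h : (lampSwitch B a)⁻¹ = lampSwitch B a⁻¹ := by
    rw [lampSwitch, lampSwitch, ← map_inv]
    congr 1
    exact Subtype.ext (Pi.mulSingle_inv (f := fun _ : B => A) 1 a).symm
  rw [h, left_mul_apply, inv_mul_cancel]
  simp [lampSwitch]

/-- The element of `A ≀ B` that moves the cursor by `b`. -/
def cursorMove (A : Type*) [Group A] (b : B) : WreathProd A B :=
  SemidirectProduct.inr b

theorem mul_cursorMove_inv_right (x : WreathProd A B) (b : B) :
    (x * (cursorMove A b)⁻¹).right = x.right * b⁻¹ := by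
  simp [cursorMove]

theorem mul_cursorMove_inv_left (x : WreathProd A B) (b : B) :
    (x * (cursorMove A b)⁻¹).left = x.left := by
  rw [cursorMove, ← map_inv, SemidirectProduct.mul_left, SemidirectProduct.left_inr, map_one,
    mul_one]

open Classical in
/-- The flow that switches off the lamp at the cursor; its net inflow is `|A| - 1` where that
lamp is off and `-1` where it is lit. -/
noncomputable def switchFlow (a : A) (x : WreathProd A B) : ℝ :=
  if (x.left : B → A) x.right * a = 1 then 1 else 0

open Classical in
theorem sum_switchFlow [Fintype A] (x : WreathProd A B) :
    ∑ a : A, (switchFlow a (x * (lampSwitch B a)⁻¹) - switchFlow a x) =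
      (if x.right ∈ lampSupport x then 0 else (Fintype.card A : ℝ)) - 1 := by
  have h1 : ∀ a : A, switchFlow a (x * (lampSwitch B a)⁻¹) =
      if x.right ∈ lampSupport x then 0 else 1 := fun a => by
    rw [switchFlow, mul_lampSwitch_inv_right, mul_lampSwitch_inv_left, inv_mul_cancel_right]
    by_cases h : (x.left : B → A) x.right = 1 <;> simp [mem_lampSupport, h]
  have h2 : ∑ a : A, switchFlow a x = 1 := by
    simp [switchFlow, mul_eq_one_iff_inv_eq]
  rw [Finset.sum_sub_distrib, h2]
  simp only [h1]
  split_ifs <;> simp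

/-- The superposition of the Pólya flows started at the lit lamps. -/
noncomputable def cursorFlow {D : ℕ} (i : Fin (D + 1))
    (x : WreathProd A (Multiplicative (Fin (D + 1) → ℤ))) : ℝ :=
  ∑ t ∈ lampSupport x, polyaFlow D i (x.right.toAdd - t.toAdd)

theorem sum_cursorFlow {D : ℕ} (x : WreathProd A (Multiplicative (Fin (D + 1) → ℤ))) :
    ∑ i, (cursorFlow i (x * (cursorMove A (Multiplicative.ofAdd (Pi.single i 1)))⁻¹) -
      cursorFlow i x) = -if x.right ∈ lampSupport x then 1 else 0 := by
  have hsupp : ∀ b, lampSupport (x * (cursorMove A b)⁻¹) = lampSupport x := fun b => by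
    ext t
    rw [mem_lampSupport, mem_lampSupport, mul_cursorMove_inv_left]
  have hmove : ∀ i (t : Multiplicative (Fin (D + 1) → ℤ)),
      (x.right * (Multiplicative.ofAdd (Pi.single i 1))⁻¹).toAdd - t.toAdd =
        x.right.toAdd - t.toAdd - Pi.single i 1 := fun i t => by
    rw [toAdd_mul, toAdd_inv, toAdd_ofAdd]
    abel
  simp only [cursorFlow, hsupp, mul_cursorMove_inv_right, hmove, ← Finset.sum_sub_distrib]
  rw [Finset.sum_comm]
  have hpt : ∀ t : Multiplicative (Fin (D + 1) → ℤ),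
      ∑ i, (polyaFlow D i (x.right.toAdd - t.toAdd - Pi.single i 1) -
        polyaFlow D i (x.right.toAdd - t.toAdd)) = -if x.right = t then 1 else 0 := fun t => by
    have h := sum_polyaFlow_sub D (x.right.toAdd - t.toAdd)
    simp only [sub_eq_zero, EmbeddingLike.apply_eq_iff_eq] at h
    rw [← h, ← Finset.sum_neg_distrib]
    exact Finset.sum_congr rfl fun i _ => (neg_sub _ _).symm
  simp only [hpt, Finset.sum_neg_distrib, Finset.sum_ite_eq]

theorem abs_cursorFlow_le {D : ℕ} (i : Fin (D + 1))
    (x : WreathProd A (Multiplicative (Fin (D + 1) → ℤ))) :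
    |cursorFlow i x| ≤
      3 * D.factorial * ((lampSupport x).card : ℝ) ^ (((D + 1 : ℕ) : ℝ)⁻¹) := by
  have hinj : Function.Injective fun t : Multiplicative (Fin (D + 1) → ℤ) =>
      x.right.toAdd - t.toAdd := fun s t h => by simpa using h
  have h := sum_polyaWeight_le D ((lampSupport x).image fun t => x.right.toAdd - t.toAdd)
  rw [Finset.sum_image hinj.injOn, Finset.card_image_of_injective _ hinj] at h
  exact (Finset.abs_sum_le_sum_abs _ _).trans <|
    (Finset.sum_le_sum fun t _ => abs_polyaFlow_le D i _).trans h

end Lamplighter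

/-- For `Γ = F ≀ ℤ^d`, `F` a nontrivial finite group and `d ≥ 2`,
the fundamental class vanishes in `H_0^f(Γ)` for `f(t) = (1+t)^{1/d}`. -/
theorem fundamental_class_vanishes_wreath_Zd
    (F : Type*) [Group F] [Finite F] [Nontrivial F] (d : ℕ) (hd : 2 ≤ d)
    (S : Finset (WreathProd F (Multiplicative (Fin d → ℤ))))
    (hsym : ∀ s ∈ S, s⁻¹ ∈ S)
    (hgen : Subgroup.closure
      (S : Set (WreathProd F (Multiplicative (Fin d → ℤ)))) = ⊤) :
    ∃ ψ : WreathProd F (Multiplicative (Fin d → ℤ)) →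
          WreathProd F (Multiplicative (Fin d → ℤ)) → ℝ,
      IsChainW (S : Set (WreathProd F (Multiplicative (Fin d → ℤ))))
        (fun t => (1 + t) ^ ((d : ℝ)⁻¹)) ψ ∧
      ∀ x, ∑ᶠ y, ψ y x = 1 := by
  obtain ⟨D, rfl⟩ : ∃ D, d = D + 1 := ⟨d - 1, by omega⟩
  have := Fintype.ofFinite F
  have hN : (1 : ℝ) < Fintype.card F := by exact_mod_cast Fintype.one_lt_card (α := F)
  set N : ℝ := (Fintype.card F : ℝ)
  have hN1 : 0 < N - 1 := by linarith
  obtain ⟨M, hM⟩ := exists_card_lampSupport_le S hsym hgen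
  set e : ℝ := ((D + 1 : ℕ) : ℝ)⁻¹
  have he : 0 ≤ e := by positivity
  let σ : Fin (D + 1) ⊕ F → WreathProd F (Multiplicative (Fin (D + 1) → ℤ)) :=
    Sum.elim (fun i => cursorMove F (Multiplicative.ofAdd (Pi.single i 1))) (lampSwitch _)
  let q : Fin (D + 1) ⊕ F → WreathProd F (Multiplicative (Fin (D + 1) → ℤ)) → ℝ :=
    Sum.elim (fun i x => -(N / (N - 1)) * cursorFlow i x) fun a x => 1 / (N - 1) * switchFlow a x
  let K : ℝ := N / (N - 1) * (3 * D.factorial * (M : ℝ) ^ e) + 1 / (N - 1)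
  have hmono : MonotoneOn (fun t : ℝ => (1 + t) ^ e) (Set.Ici 0) := fun s hs t _ hst =>
    Real.rpow_le_rpow (add_nonneg zero_le_one hs) (by linarith) he
  refine ⟨edgeChain σ q, isChainW_edgeChain σ q _ hmono (K := K) ?_ (by positivity) (by simp),
    fun x => ?_⟩
  · intro j x
    set L : ℝ := (wLen (S : Set (WreathProd F (Multiplicative (Fin (D + 1) → ℤ)))) x : ℝ)
    have hL : 0 ≤ L := Nat.cast_nonneg _
    have hL1 : 1 ≤ (1 + L) ^ e := Real.one_le_rpow (by linarith) he
    rcases j with i | a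
    · have hcard : ((lampSupport x).card : ℝ) ^ e ≤ (M : ℝ) ^ e * (1 + L) ^ e := by
        rw [← Real.mul_rpow (by positivity) (by positivity)]
        refine Real.rpow_le_rpow (by positivity) ?_ he
        have h1 : ((lampSupport x).card : ℝ) ≤ M * L := by simp only [L]; exact_mod_cast hM x
        exact h1.trans (by gcongr; linarith)
      calc |q (Sum.inl i) x| = N / (N - 1) * |cursorFlow i x| := by
            simp only [q, Sum.elim_inl]
            rw [abs_mul, abs_neg, abs_of_nonneg (by positivity)]
        _ ≤ N / (N - 1) * (3 * D.factorial * ((M : ℝ) ^ e * (1 + L) ^ e)) := by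
            gcongr
            exact (abs_cursorFlow_le i x).trans (by gcongr)
        _ ≤ K * (1 + L) ^ e := by
            have : 0 ≤ 1 / (N - 1) * (1 + L) ^ e := by positivity
            simp only [K]
            linarith
    · have hs : |switchFlow a x| ≤ 1 := by
        unfold switchFlow
        split_ifs <;> simp
      calc |q (Sum.inr a) x| = 1 / (N - 1) * |switchFlow a x| := by
            simp only [q, Sum.elim_inr]
            rw [abs_mul, abs_of_nonneg (by positivity)]
        _ ≤ 1 / (N - 1) * (1 + L) ^ e := by
            gcongr
            exact hs.trans hL1
        _ ≤ K * (1 + L) ^ e := by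
            gcongr
            exact le_add_of_nonneg_left (by positivity)
  · rw [finsum_edgeChain, Fintype.sum_sum_type]
    simp only [σ, q, Sum.elim_inl, Sum.elim_inr, ← mul_sub, ← Finset.mul_sum]
    rw [sum_cursorFlow, sum_switchFlow]
    split_ifs <;> field_simp <;> ring
end

section
/- Let X be an infinite, uniformly discrete, bounded geometry, quasi-geodesic metric space and let f be a control function which is slowly growing: for every ε > 0 there is t_0 such that f(t+1) ≤ f(t) + ε for all t > t_0. If the class [1/f] vanishes in H_0^{uf}(X) — i.e. there exists a bounded, finite-propagation function φ : X × X → ℝ with φ(x,y) = −φ(y,x) and ∑_{y} φ(y,x) = 1/f(|x|) for all x ∈ X — then the fundamental class [X] vanishes in H_0^f(X): there exists an f-controlled 1-chain ψ with ∂ψ(x) = 1 for all x ∈ X. -/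
/-- A metric space is uniformly discrete if distinct points are uniformly separated. -/
def UnifDiscrete (X : Type*) [MetricSpace X] : Prop :=
  ∃ c > (0:ℝ), ∀ x y : X, x ≠ y → c ≤ dist x y

/-- A metric space has bounded geometry if balls of each radius have uniformly
bounded (finite) cardinality. -/
def BddGeom (X : Type*) [MetricSpace X] : Prop :=
  ∀ r > (0:ℝ), ∃ N : ℕ, ∀ x : X,
    (Metric.closedBall x r).Finite ∧ (Metric.closedBall x r).ncard ≤ N

/-- Quasi-geodesic: any two points are joined by a chain of `≤ d(x,y)` unit steps. -/
def QuasiGeodesic (X : Type*) [MetricSpace X] : Prop :=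
  ∀ x y : X, ∃ n : ℕ, ∃ p : ℕ → X,
    p 0 = x ∧ p n = y ∧ (∀ i < n, dist (p i) (p (i + 1)) ≤ 1) ∧ (n : ℝ) ≤ dist x y

/-- A control function: non-decreasing, nonnegative on `[0,∞)`, `f 0 = 1`, with
controlled behaviour under additive shifts and multiplicative rescalings. -/
structure IsControlFun (f : ℝ → ℝ) : Prop where
  nonneg : ∀ t : ℝ, 0 ≤ t → 0 ≤ f t
  mono : ∀ s t : ℝ, 0 ≤ s → s ≤ t → f s ≤ f t
  one_at_zero : f 0 = 1
  shift : ∀ K > (0:ℝ), ∃ L > (0:ℝ), ∀ t > (0:ℝ), f (t + K) ≤ L * f t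
  scale : ∀ K > (0:ℝ), ∃ L > (0:ℝ), ∀ t > (0:ℝ), f (K * t) ≤ L * f t

/-- An `f`-controlled 1-chain on `X` with basepoint `e`: antisymmetric, of finite
propagation, with coefficients bounded by a multiple of `f (max |x| |y|)`. -/
structure IsCtrlChain {X : Type*} [MetricSpace X] (e : X) (f : ℝ → ℝ) (ψ : X → X → ℝ) : Prop where
  antisymm : ∀ x y, ψ x y = - ψ y x
  finprop : ∃ R > (0:ℝ), ∀ x y, R < dist x y → ψ x y = 0
  bound : ∃ K > (0:ℝ), ∀ x y, |ψ x y| ≤ K * f (max (dist x e) (dist y e))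

/-- The nonnegative edge flows dominated by `c` whose net inflow at every point is at least `1`. -/
def dominatedFlows {X : Type*} (B : X → Finset X) (c : X → X → ℝ) : Set (X → X → ℝ) :=
  {θ | (∀ x y, 0 ≤ θ x y) ∧ (∀ x y, θ x y ≤ c x y) ∧ ∀ x, 1 ≤ ∑ y ∈ B x, (θ y x - θ x y)}

theorem isClosed_dominatedFlows {X : Type*} (B : X → Finset X) (c : X → X → ℝ) :
    IsClosed (dominatedFlows B c) := by
  have hc : ∀ x y : X, Continuous fun θ : X → X → ℝ => θ x y := fun x y => by fun_prop
  simp only [dominatedFlows, Set.ofPred_and, Set.ofPred_forall]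
  refine .inter ?_ (.inter ?_ ?_)
  · exact isClosed_iInter fun x => isClosed_iInter fun y => isClosed_le continuous_const (hc x y)
  · exact isClosed_iInter fun x => isClosed_iInter fun y => isClosed_le (hc x y) continuous_const
  · exact isClosed_iInter fun x => isClosed_le continuous_const
      (continuous_finsetSum _ fun y _ => (hc y x).sub (hc x y))

theorem isCompact_dominatedFlows {X : Type*} (B : X → Finset X) (c : X → X → ℝ) :
    IsCompact (dominatedFlows B c) := by
  have h : IsCompact (Set.univ.pi fun x => Set.univ.pi fun y => Set.Icc (0 : ℝ) (c x y)) :=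
    isCompact_univ_pi fun x => isCompact_univ_pi fun y => isCompact_Icc
  exact h.of_isClosed_subset (isClosed_dominatedFlows B c)
    fun θ hθ x _ y _ => ⟨hθ.1 x y, hθ.2.1 x y⟩

theorem exists_minimal_dominatedFlow {X : Type*} (B : X → Finset X) (c : X → X → ℝ)
    (hne : (dominatedFlows B c).Nonempty) :
    ∃ θ, Minimal (· ∈ dominatedFlows B c) θ := by
  suffices h : ∀ C ⊆ dominatedFlows B c, IsChain (· ≤ ·) C →
      ∃ θ ∈ dominatedFlows B c, ∀ a ∈ C, θ ≤ a from
    @zorn_le₀ (X → X → ℝ)ᵒᵈ _ (dominatedFlows B c) fun C hCS hC => h C hCS hC.symm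
  intro C hCS hC
  rcases C.eq_empty_or_nonempty with rfl | hCne
  · exact hne.imp fun θ hθ => ⟨hθ, by simp⟩
  have : Nonempty C := hCne.to_subtype
  have hcl : ∀ a : C, IsClosed (dominatedFlows B c ∩ Set.Iic a.1) := fun a =>
    (isClosed_dominatedFlows B c).inter isClosed_Iic
  obtain ⟨θ, hθ⟩ := IsCompact.nonempty_iInter_of_directed_nonempty_isCompact_isClosed
    (fun a : C => dominatedFlows B c ∩ Set.Iic a.1)
    (fun a b => by
      rcases hC.total a.2 b.2 with h | h
      · exact ⟨a, le_rfl, Set.inter_subset_inter_right _ (Set.Iic_subset_Iic.2 h)⟩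
      · exact ⟨b, Set.inter_subset_inter_right _ (Set.Iic_subset_Iic.2 h), le_rfl⟩)
    (fun a => ⟨a.1, hCS a.2, Set.self_mem_Iic⟩)
    (fun a => (isCompact_dominatedFlows B c).of_isClosed_subset (hcl a) Set.inter_subset_left)
    hcl
  rw [Set.mem_iInter] at hθ
  exact ⟨θ, (hθ ⟨_, hCne.some_mem⟩).1, fun a ha => (hθ ⟨a, ha⟩).2⟩

/-- A minimal flow with net inflow at least `1` has net inflow exactly `1`: any surplus at a point
could be removed by decreasing the flow along an incoming edge. -/
theorem sum_eq_one_of_minimal_dominatedFlow {X : Type*} {B : X → Finset X} {c θ : X → X → ℝ}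
    (hθ : Minimal (· ∈ dominatedFlows B c) θ) (x₀ : X) :
    ∑ y ∈ B x₀, (θ y x₀ - θ x₀ y) = 1 := by
  classical
  obtain ⟨h0, hc, h1⟩ := hθ.prop
  by_contra hne
  have hgt : 1 < ∑ y ∈ B x₀, (θ y x₀ - θ x₀ y) := lt_of_le_of_ne (h1 x₀) (Ne.symm hne)
  obtain ⟨y₁, hy₁, hpos⟩ : ∃ y ∈ B x₀, 0 < θ y x₀ - θ x₀ y := by
    by_contra! h
    linarith [Finset.sum_nonpos h]
  have hxy : y₁ ≠ x₀ := by
    rintro rfl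
    simp at hpos
  set ε := min (θ y₁ x₀) (∑ y ∈ B x₀, (θ y x₀ - θ x₀ y) - 1) with hε
  have hθpos : 0 < θ y₁ x₀ := by linarith [h0 x₀ y₁]
  have hεpos : 0 < ε := lt_min hθpos (by linarith)
  have hε₁ : ε ≤ θ y₁ x₀ := min_le_left _ _
  have hε₂ : ε ≤ ∑ y ∈ B x₀, (θ y x₀ - θ x₀ y) - 1 := min_le_right _ _
  let δ : X → X → ℝ := fun a b => if a = y₁ ∧ b = x₀ then ε else 0
  have hδ : ∀ a b, 0 ≤ δ a b := fun a b => by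
    simp only [δ]
    split_ifs <;> linarith
  have hle : (fun a b => θ a b - δ a b) ≤ θ := fun a b => sub_le_self _ (hδ a b)
  have hmem : (fun a b => θ a b - δ a b) ∈ dominatedFlows B c := by
    refine ⟨fun a b => ?_, fun a b => (hle a b).trans (hc a b), fun x => ?_⟩
    · simp only [δ]
      split_ifs with h
      · rw [h.1, h.2]; linarith
      · linarith [h0 a b]
    · have hsplit : ∑ y ∈ B x, (θ y x - δ y x - (θ x y - δ x y)) =
          ∑ y ∈ B x, (θ y x - θ x y) - ∑ y ∈ B x, δ y x + ∑ y ∈ B x, δ x y := by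
        rw [← Finset.sum_sub_distrib, ← Finset.sum_add_distrib]
        exact Finset.sum_congr rfl fun y _ => by ring
      have hin : 0 ≤ ∑ y ∈ B x, δ x y := Finset.sum_nonneg fun y _ => hδ x y
      rw [hsplit]
      by_cases hx : x = x₀
      · subst hx
        have : ∑ y ∈ B x, δ y x = ε := by simp [δ, hy₁]
        linarith
      · have : ∑ y ∈ B x, δ y x = 0 := by simp [δ, hx]
        linarith [h1 x]
  have := hθ.le_of_le hmem hle y₁ x₀
  simp only [δ, and_self, if_true] at this
  linarith

/-- An antisymmetric function whose boundary is at least `1` everywhere dominates one whose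
boundary is exactly `1`. -/
theorem exists_abs_le_sum_eq_one {X : Type*} (B : X → Finset X) (p : X → X → ℝ)
    (hp : ∀ x y, p x y = -p y x) (hsum : ∀ x, 1 ≤ ∑ y ∈ B x, p y x) :
    ∃ q : X → X → ℝ, (∀ x y, q x y = -q y x) ∧ (∀ x y, |q x y| ≤ |p x y|) ∧
      ∀ x, ∑ y ∈ B x, q y x = 1 := by
  obtain ⟨θ, hθ⟩ := exists_minimal_dominatedFlow B (fun x y => |p x y|)
    ⟨fun x y => max (p x y) 0, fun x y => le_max_right _ _,
      fun x y => max_le (le_abs_self _) (abs_nonneg _), fun x => by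
        refine (hsum x).trans_eq (Finset.sum_congr rfl fun y _ => ?_)
        simp only [hp x y, max_zero_sub_eq_self]⟩
  refine ⟨fun x y => θ x y - θ y x, fun x y => by ring, fun x y => ?_,
    sum_eq_one_of_minimal_dominatedFlow hθ⟩
  have hsymm : |p y x| = |p x y| := by rw [hp y x, abs_neg]
  have h₁ := hθ.prop.2.1 x y
  have h₂ := hθ.prop.2.1 y x
  simp only [hsymm] at h₁ h₂
  rw [abs_le]
  constructor <;> linarith [hθ.prop.1 x y, hθ.prop.1 y x]

theorem apply_add_natCast_le {f : ℝ → ℝ} {ε t₀ : ℝ}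
    (h : ∀ t > t₀, f (t + 1) ≤ f t + ε) (n : ℕ) {t : ℝ} (ht : t₀ < t) :
    f (t + n) ≤ f t + n * ε := by
  induction n with
  | zero => simp
  | succ n ih =>
    have hn : t₀ < t + n := ht.trans_le (le_add_of_nonneg_right n.cast_nonneg)
    have := h (t + n) hn
    push_cast
    rw [← add_assoc]
    linarith

/-- The chain obtained from `φ` by multiplying with `f` has boundary close to `1` far from the
basepoint; adding a multiple of `φ` makes the boundary positive near the basepoint as well. -/
theorem exists_chain_one_le_boundary {X : Type*} [MetricSpace X] (e : X) {f : ℝ → ℝ}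
    (hf : IsControlFun f)
    (hslow : ∀ ε > (0 : ℝ), ∃ t₀ : ℝ, ∀ t > t₀, f (t + 1) ≤ f t + ε)
    {φ : X → X → ℝ} (hanti : ∀ x y, φ x y = -φ y x)
    {M : ℝ} (hM : 0 ≤ M) (hbdd : ∀ x y, |φ x y| ≤ M)
    {R : ℝ} (hR : 0 < R) (hprop : ∀ x y, R < dist x y → φ x y = 0)
    {B : X → Finset X} (hB : ∀ x y, y ∈ B x ↔ dist y x ≤ R)
    {N : ℕ} (hN : ∀ x, (B x).card ≤ N)
    (hbd : ∀ x, ∑ y ∈ B x, φ y x = 1 / f (dist x e)) :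
    ∃ p : X → X → ℝ, IsCtrlChain e f p ∧ (∀ x y, R < dist x y → p x y = 0) ∧
      ∀ x, 1 ≤ ∑ y ∈ B x, p y x := by
  have hf1 : ∀ t, 0 ≤ t → 1 ≤ f t := fun t ht => hf.one_at_zero ▸ hf.mono 0 t le_rfl ht
  set n := ⌈R⌉₊
  have hn : R ≤ n := Nat.le_ceil R
  have hC : 0 ≤ N * M * n := by positivity
  set ε := 1 / (2 * (N * M * n + 1)) with hεdef
  have hε : 0 < ε := by positivity
  have hCε : N * M * n * ε ≤ 1 / 2 := by
    rw [hεdef, mul_one_div, div_le_div_iff₀ (by positivity) (by norm_num)]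
    linarith
  obtain ⟨t₁, ht₁⟩ := hslow ε hε
  set t₀ := max t₁ 0
  have ht₀ : 0 ≤ t₀ := le_max_right _ _
  have hslow' : ∀ t > t₀, f (t + 1) ≤ f t + ε := fun t ht =>
    ht₁ t ((le_max_left _ _).trans_lt ht)
  let F : X → X → ℝ := fun x y => f (max (dist x e) (dist y e))
  have hF1 : ∀ x y, 1 ≤ F x y := fun x y => hf1 _ (le_max_of_le_left dist_nonneg)
  have hFcomm : ∀ x y, F x y = F y x := fun x y => by simp only [F, max_comm]
  have hFle : ∀ x, ∀ y ∈ B x, F y x ≤ f (dist x e + n) := fun x y hy => by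
    refine hf.mono _ _ (le_max_of_le_left dist_nonneg) (max_le ?_ ?_)
    · linarith [dist_triangle y x e, (hB x y).1 hy]
    · linarith
  have hFge : ∀ x y, f (dist x e) ≤ F y x := fun x y =>
    hf.mono _ _ dist_nonneg (le_max_right _ _)
  set D := N * M * f (t₀ + n)
  have hD : 0 ≤ D := by
    have := hf.nonneg (t₀ + n) (by positivity)
    positivity
  set A := f t₀ * (1 / 2 + D)
  have hA : 0 ≤ A := mul_nonneg (hf.nonneg _ ht₀) (by linarith)
  -- a sum of `N` terms weighted by `φ` is controlled by the largest weight
  have hsum : ∀ x, ∀ G : X → ℝ, ∀ b, 0 ≤ b → (∀ y ∈ B x, 0 ≤ G y ∧ G y ≤ b) →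
      -(N * M * b) ≤ ∑ y ∈ B x, φ y x * G y := fun x G b hb hG => by
    have h₁ : ∑ y ∈ B x, -(M * b) ≤ ∑ y ∈ B x, φ y x * G y := by
      refine Finset.sum_le_sum fun y hy => (abs_le.1 ?_).1
      rw [abs_mul, abs_of_nonneg (hG y hy).1]
      exact mul_le_mul (hbdd _ _) (hG y hy).2 (hG y hy).1 hM
    rw [Finset.sum_const, nsmul_eq_mul] at h₁
    have h₂ : ((B x).card : ℝ) ≤ N := by exact_mod_cast hN x
    nlinarith [mul_le_mul_of_nonneg_right h₂ (mul_nonneg hM hb)]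
  refine ⟨fun x y => 2 * (φ x y * F x y + A * φ x y),
    ⟨fun x y => ?_, ⟨R, hR, fun x y h => ?_⟩, ⟨2 * (M + A * M) + 1, by positivity, fun x y => ?_⟩⟩,
    fun x y h => ?_, fun x => ?_⟩
  · rw [hanti x y, hFcomm x y]; ring
  · simp [hprop x y h]
  · have hF := hF1 x y
    have hF0 : 0 ≤ F x y := by linarith
    change _ ≤ _ * F x y
    have h₁ : 2 * (φ x y * F x y + A * φ x y) = φ x y * (2 * (F x y + A)) := by ring
    rw [h₁, abs_mul, abs_of_nonneg (by positivity : 0 ≤ 2 * (F x y + A))]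
    have h₂ := mul_le_mul_of_nonneg_right (hbdd x y) (by positivity : 0 ≤ 2 * (F x y + A))
    have h₃ := mul_le_mul_of_nonneg_left hF (mul_nonneg hM hA)
    nlinarith
  · simp [hprop x y h]
  · have hfx : 0 < f (dist x e) := by linarith [hf1 (dist x e) dist_nonneg]
    have hexp : ∑ y ∈ B x, 2 * (φ y x * F y x + A * φ y x) =
        2 * (∑ y ∈ B x, φ y x * F y x + A * (1 / f (dist x e))) := by
      rw [← Finset.mul_sum, Finset.sum_add_distrib, ← Finset.mul_sum, hbd x]
    rw [hexp]
    suffices 1 / 2 ≤ ∑ y ∈ B x, φ y x * F y x + A * (1 / f (dist x e)) by linarith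
    rcases lt_or_ge t₀ (dist x e) with hx | hx
    · have hsplit : ∑ y ∈ B x, φ y x * F y x =
          1 + ∑ y ∈ B x, φ y x * (F y x - f (dist x e)) := by
        simp only [mul_sub]
        rw [Finset.sum_sub_distrib, ← Finset.sum_mul, hbd x, one_div_mul_cancel hfx.ne']
        ring
      have h₁ := hsum x (fun y => F y x - f (dist x e)) (n * ε) (by positivity) fun y hy =>
        ⟨sub_nonneg.2 (hFge x y), by
          linarith [hFle x y hy, apply_add_natCast_le hslow' n hx]⟩
      have h₂ : 0 ≤ A * (1 / f (dist x e)) := by positivity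
      rw [hsplit]
      linarith
    · have h₁ := hsum x (fun y => F y x) (f (t₀ + n)) (hf.nonneg _ (by positivity)) fun y hy =>
        ⟨by linarith [hF1 y x], (hFle x y hy).trans
          (hf.mono _ _ (by positivity) (by linarith))⟩
      have h₂ : 1 / 2 + D ≤ A * (1 / f (dist x e)) := by
        rw [mul_one_div, le_div_iff₀ hfx, mul_comm]
        exact mul_le_mul_of_nonneg_right (hf.mono _ _ dist_nonneg hx) (by linarith)
      linarith

/-- If `f` is slowly growing and the class `[1/f]` vanishes in
uniformly finite homology, then the fundamental class vanishes in `H_0^f(X)`. -/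
theorem fundamental_class_vanishes_of_one_over_f_class_vanishes
    {X : Type*} [MetricSpace X] [Infinite X] (e : X) (f : ℝ → ℝ)
    (hud : UnifDiscrete X) (hbg : BddGeom X) (hqg : QuasiGeodesic X)
    (hf : IsControlFun f)
    (hslow : ∀ ε > (0:ℝ), ∃ t₀ : ℝ, ∀ t > t₀, f (t + 1) ≤ f t + ε)
    (φ : X → X → ℝ)
    (hanti : ∀ x y, φ x y = - φ y x)
    (hbdd : ∃ M : ℝ, ∀ x y, |φ x y| ≤ M)
    (hprop : ∃ R > (0:ℝ), ∀ x y, R < dist x y → φ x y = 0)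
    (hbd : ∀ x : X, ∑ᶠ y : X, φ y x = 1 / f (dist x e)) :
    ∃ ψ : X → X → ℝ, IsCtrlChain e f ψ ∧ ∀ x : X, ∑ᶠ y : X, ψ y x = 1 := by
  obtain ⟨M, hM⟩ := hbdd
  obtain ⟨R, hR, hprop⟩ := hprop
  obtain ⟨N, hN⟩ := hbg R hR
  let B : X → Finset X := fun x => (hN x).1.toFinset
  have hB : ∀ x y, y ∈ B x ↔ dist y x ≤ R := fun x y => by simp [B]
  have hcard : ∀ x, (B x).card ≤ N := fun x => by
    rw [← Set.ncard_eq_toFinset_card _ (hN x).1]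
    exact (hN x).2
  have hfin : ∀ g : X → X → ℝ, (∀ x y, R < dist x y → g x y = 0) →
      ∀ x, ∑ᶠ y, g y x = ∑ y ∈ B x, g y x := fun g hg x =>
    finsum_eq_sum_of_support_subset _ fun y hy =>
      (hB x y).2 (not_lt.1 fun h => hy (hg y x h))
  obtain ⟨p, hp, hpR, hp1⟩ := exists_chain_one_le_boundary e hf hslow hanti
    ((abs_nonneg _).trans (hM e e)) hM hR hprop hB hcard
    fun x => (hfin φ hprop x).symm.trans (hbd x)
  obtain ⟨q, hq, hqp, hq1⟩ := exists_abs_le_sum_eq_one B p hp.antisymm hp1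
  have hqR : ∀ x y, R < dist x y → q x y = 0 := fun x y h => by
    simpa [hpR x y h] using hqp x y
  obtain ⟨K, hK, hpK⟩ := hp.bound
  exact ⟨q, ⟨hq, ⟨R, hR, hqR⟩, ⟨K, hK, fun x y => (hqp x y).trans (hpK x y)⟩⟩,
    fun x => (hfin q hqR x).trans (hq1 x)⟩
end

section
/- Let X be a uniformly discrete metric space of bounded geometry, f a control function, φ an f-controlled 1-chain on X, and C > 0 a constant with ∂φ(x) ≥ C for all x ∈ X. Then there exists an f-controlled 1-chain ψ on X taking values in ℤ, with propagation at most the propagation of φ, such that ∂ψ(x) ≥ 1 for all x ∈ X. -/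
/-- Rounding of a real number to an integer, towards zero. -/
noncomputable def roundToZero (a : ℝ) : ℤ := if 0 ≤ a then ⌊a⌋ else ⌈a⌉

theorem roundToZero_zero : roundToZero 0 = 0 := by simp [roundToZero]

theorem roundToZero_neg (a : ℝ) : roundToZero (-a) = -roundToZero a := by
  unfold roundToZero
  rcases lt_trichotomy a 0 with h | rfl | h
  · rw [if_pos (by linarith), if_neg (by linarith), Int.floor_neg]
  · simp
  · rw [if_neg (by linarith), if_pos h.le, Int.ceil_neg]

theorem abs_roundToZero_le (a : ℝ) : |(roundToZero a : ℝ)| ≤ |a| := by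
  unfold roundToZero
  split_ifs with h
  · rw [abs_of_nonneg h, abs_of_nonneg (by exact_mod_cast Int.floor_nonneg.2 h)]
    exact Int.floor_le a
  · have h' : a ≤ 0 := (not_le.1 h).le
    have hc : (⌈a⌉ : ℝ) ≤ 0 := by exact_mod_cast Int.ceil_le.2 (by simpa using h')
    rw [abs_of_nonpos h', abs_of_nonpos hc]
    exact neg_le_neg (Int.le_ceil a)

theorem sub_one_le_roundToZero (a : ℝ) : a - 1 ≤ roundToZero a := by
  unfold roundToZero
  split_ifs
  · exact (Int.sub_one_lt_floor a).le
  · linarith [Int.le_ceil a]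

/-- Rounding a finitely supported function towards zero lowers its sum by at most the size of
any finite set containing the support. -/
theorem finsum_sub_card_le_finsum_roundToZero {α : Type*} (g : α → ℝ) (s : Finset α)
    (hs : ∀ y ∉ s, g y = 0) :
    ∑ᶠ y, g y - s.card ≤ ∑ᶠ y, (roundToZero (g y) : ℝ) := by
  have hg : Function.support g ⊆ s := fun y hy => by
    by_contra h
    exact hy (hs y h)
  have hr : Function.support (fun y => (roundToZero (g y) : ℝ)) ⊆ s := fun y hy => by
    by_contra h
    exact hy (by simp [hs y h, roundToZero_zero])
  rw [finsum_eq_sum_of_support_subset _ hg, finsum_eq_sum_of_support_subset _ hr]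
  have := Finset.sum_le_sum fun y (_ : y ∈ s) => sub_one_le_roundToZero (g y)
  simpa [Finset.sum_sub_distrib] using this

/-- An `f`-controlled 1-chain whose boundary is bounded below by
a positive constant can be replaced by an integer-valued `f`-controlled 1-chain
with no larger propagation whose boundary is `≥ 1` everywhere. -/
theorem integral_chain_of_bounded_below_boundary
    {X : Type*} [MetricSpace X] (e : X) (f : ℝ → ℝ)
    (hud : UnifDiscrete X) (hbg : BddGeom X) (hf : IsControlFun f)
    (φ : X → X → ℝ) (hφ : IsCtrlChain e f φ)
    (C : ℝ) (hC : 0 < C)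
    (hlb : ∀ x : X, C ≤ ∑ᶠ y : X, φ y x) :
    ∃ ψ : X → X → ℝ, IsCtrlChain e f ψ ∧
      (∀ x y, ∃ m : ℤ, ψ x y = (m : ℝ)) ∧
      (∀ R > (0:ℝ), (∀ x y, R < dist x y → φ x y = 0) →
        ∀ x y, R < dist x y → ψ x y = 0) ∧
      (∀ x : X, 1 ≤ ∑ᶠ y : X, ψ y x) := by
  obtain ⟨R, hR, hφR⟩ := hφ.finprop
  obtain ⟨K, hK, hφK⟩ := hφ.bound
  obtain ⟨N, hN⟩ := hbg R hR
  set l : ℝ := (N + 1) / C with hl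
  have hl0 : 0 < l := by positivity
  refine ⟨fun x y => roundToZero (l * φ x y), ⟨fun x y => ?_, ⟨R, hR, fun x y h => ?_⟩,
    ⟨l * K, by positivity, fun x y => ?_⟩⟩, fun x y => ⟨_, rfl⟩, fun S _ hS x y h => ?_,
    fun x => ?_⟩
  · rw [hφ.antisymm x y, mul_neg, roundToZero_neg, Int.cast_neg]
  · simp [hφR x y h, roundToZero_zero]
  · calc |(roundToZero (l * φ x y) : ℝ)| ≤ |l * φ x y| := abs_roundToZero_le _
      _ = l * |φ x y| := by rw [abs_mul, abs_of_pos hl0]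
      _ ≤ l * (K * f (max (dist x e) (dist y e))) := by gcongr; exact hφK x y
      _ = l * K * f (max (dist x e) (dist y e)) := by ring
  · simp [hS x y h, roundToZero_zero]
  · obtain ⟨hfin, hcard⟩ := hN x
    have hround := finsum_sub_card_le_finsum_roundToZero (fun y => l * φ y x) hfin.toFinset
      fun y hy => by
        rw [hφR y x (by simpa using hy), mul_zero]
    rw [← mul_finsum, ← Set.ncard_eq_toFinset_card _ hfin] at hround
    have hsum : (N : ℝ) + 1 ≤ l * ∑ᶠ y, φ y x :=
      calc (N : ℝ) + 1 = l * C := by rw [hl]; field_simp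
        _ ≤ _ := mul_le_mul_of_nonneg_left (hlb x) hl0.le
    have hcard' : ((Metric.closedBall x R).ncard : ℝ) ≤ N := by exact_mod_cast hcard
    linarith
end

section
/- Let X be a uniformly discrete metric space of bounded geometry and f a control function. If ψ is an f-controlled 1-chain on X taking values in ℤ with ∂ψ(x) ≥ 1 for all x ∈ X, then there exists an f-controlled 1-chain ψ' on X with ∂ψ'(x) = 1 for all x ∈ X; in particular the fundamental class [X] vanishes in H_0^f(X). -/
/-- The net inflow at `x` of an edge weight `m`, computed over the finite set `B x` of neighbours. -/
def netInflow {X : Type*} (B : X → Finset X) (m : X → X → ℝ) (x : X) : ℝ :=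
  ∑ y ∈ B x, (m y x - m x y)

theorem continuous_netInflow {X : Type*} (B : X → Finset X) (x : X) :
    Continuous fun m : X → X → ℝ => netInflow B m x := by
  unfold netInflow
  fun_prop

/-- A nonnegative edge weight with net inflow at least `1` everywhere dominates a minimal one. -/
theorem exists_minimal_netInflow_ge_one {X : Type*} (B : X → Finset X) (w : X → X → ℝ)
    (hw : 0 ≤ w) (hB : ∀ x, 1 ≤ netInflow B w x) :
    ∃ m ≤ w, Minimal (fun m : X → X → ℝ => 0 ≤ m ∧ ∀ x, 1 ≤ netInflow B m x) m := by
  refine zorn_le_nonempty₀ (α := (X → X → ℝ)ᵒᵈ)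
    {m : X → X → ℝ | 0 ≤ m ∧ ∀ x, 1 ≤ netInflow B m x} ?_ w ⟨hw, hB⟩
  intro c hc hchain m₀ hm₀
  let C : Set (X → X → ℝ) := c
  have hchain' : IsChain (· ≤ ·) C := hchain.symm
  have hbdd : ∀ x y, BddBelow (Set.range fun m : C => m.1 x y) := fun x y =>
    ⟨0, by rintro _ ⟨m, rfl⟩; exact (hc m.2).1 x y⟩
  have : Nonempty C := ⟨⟨m₀, hm₀⟩⟩
  have : IsCodirectedOrder C := ⟨fun a b => by
    rcases hchain'.total a.2 b.2 with h | h
    · exact ⟨a, le_rfl, h⟩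
    · exact ⟨b, h, le_rfl⟩⟩
  let l : X → X → ℝ := fun x y => ⨅ m : C, m.1 x y
  have hlim : Filter.Tendsto (fun m : C => m.1) Filter.atBot (nhds l) := by
    refine tendsto_pi_nhds.2 fun x => tendsto_pi_nhds.2 fun y => ?_
    exact tendsto_atBot_ciInf (fun a b h => h x y) (hbdd x y)
  refine ⟨l, ⟨fun x y => le_ciInf fun m => (hc m.2).1 x y, fun x => ?_⟩, ?_⟩
  · exact ge_of_tendsto' (((continuous_netInflow B x).tendsto l).comp hlim) fun m => (hc m.2).2 x
  · intro m hm x y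
    exact ciInf_le (hbdd x y) ⟨m, hm⟩

/-- A minimal nonnegative edge weight with net inflow at least `1` has net inflow exactly `1`:
lowering the weight of an edge into `x` only raises the net inflow at other vertices. -/
theorem netInflow_eq_one_of_minimal {X : Type*} (B : X → Finset X) {m : X → X → ℝ}
    (hm : Minimal (fun m : X → X → ℝ => 0 ≤ m ∧ ∀ x, 1 ≤ netInflow B m x) m) (x : X) :
    netInflow B m x = 1 := by
  classical
  obtain ⟨h0, h1⟩ := hm.prop
  refine le_antisymm ?_ (h1 x)
  by_contra! hx
  obtain ⟨y, hy, hpos⟩ : ∃ y ∈ B x, 0 < m y x - m x y :=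
    Finset.exists_lt_of_sum_lt (by simpa [netInflow] using zero_lt_one.trans hx)
  have hyx : y ≠ x := by
    rintro rfl
    simp at hpos
  have hmpos : 0 < m y x := by linarith [h0 x y, show (0 : X → X → ℝ) x y = 0 from rfl]
  obtain ⟨ε, hε, hεm, hεx⟩ : ∃ ε > 0, ε ≤ m y x ∧ ε ≤ netInflow B m x - 1 :=
    ⟨min (m y x) (netInflow B m x - 1), lt_min hmpos (by linarith), min_le_left _ _,
      min_le_right _ _⟩
  let m' : X → X → ℝ := fun a b => m a b - if a = y ∧ b = x then ε else 0
  have hle : m' ≤ m := fun a b => by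
    dsimp only [m']
    split_ifs <;> linarith
  have hm' : 0 ≤ m' ∧ ∀ z, 1 ≤ netInflow B m' z := by
    refine ⟨fun a b => ?_, fun z => ?_⟩
    · dsimp only [m']
      split_ifs with h
      · obtain ⟨rfl, rfl⟩ := h
        simpa using hεm
      · simpa using h0 a b
    · by_cases hz : z = x
      · subst hz
        have : netInflow B m' z = netInflow B m z - ε := by
          have hsum : ∑ a ∈ B z, (if a = y then ε else 0) = ε := by simp [hy]
          rw [netInflow, netInflow, ← hsum, ← Finset.sum_sub_distrib]
          refine Finset.sum_congr rfl fun a _ => ?_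
          simp only [m', hyx.symm, false_and, and_true, if_false]
          ring
        linarith
      · refine (h1 z).trans (Finset.sum_le_sum fun a _ => ?_)
        have : m' a z = m a z := by simp [m', hz]
        linarith [hle z a]
  have := hm.le_of_le hm' hle y x
  simp only [m', and_self, if_true] at this
  linarith

/-- An integer-valued `f`-controlled 1-chain with boundary `≥ 1`
everywhere yields an `f`-controlled 1-chain with boundary exactly `1`; hence the
fundamental class vanishes in `H_0^f(X)`. -/
theorem fundamental_class_vanishes_of_integral_chain
    {X : Type*} [MetricSpace X] (e : X) (f : ℝ → ℝ)
    (hud : UnifDiscrete X) (hbg : BddGeom X) (hf : IsControlFun f)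
    (ψ : X → X → ℝ) (hψ : IsCtrlChain e f ψ)
    (hint : ∀ x y, ∃ m : ℤ, ψ x y = (m : ℝ))
    (hlb : ∀ x : X, 1 ≤ ∑ᶠ y : X, ψ y x) :
    ∃ ψ' : X → X → ℝ, IsCtrlChain e f ψ' ∧ ∀ x : X, ∑ᶠ y : X, ψ' y x = 1 := by
  obtain ⟨R, hR, hprop⟩ := hψ.finprop
  obtain ⟨N, hN⟩ := hbg R hR
  let B : X → Finset X := fun x => (hN x).1.toFinset
  have finsum_eq : ∀ φ : X → X → ℝ, (∀ x y, R < dist x y → φ x y = 0) → ∀ x,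
      ∑ᶠ y, φ y x = ∑ y ∈ B x, φ y x := by
    refine fun φ hφ x => finsum_eq_sum_of_support_subset _ fun y hy => ?_
    by_contra h
    refine hy (hφ y x ?_)
    simpa [B] using h
  let w : X → X → ℝ := fun x y => max (ψ x y) 0
  have hw : ∀ x y, w x y - w y x = ψ x y := fun x y => by
    dsimp only [w]
    rw [hψ.antisymm y x]
    exact max_zero_sub_max_neg_zero_eq_self _
  obtain ⟨m, hmw, hm⟩ := exists_minimal_netInflow_ge_one B w (fun x y => le_max_right _ _)
    fun x => by simpa only [netInflow, hw, ← finsum_eq ψ hprop] using hlb x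
  have habs : ∀ x y, |m x y - m y x| ≤ |ψ x y| := fun x y => by
    have h1 : 0 ≤ m x y := hm.prop.1 x y
    have h2 : 0 ≤ m y x := hm.prop.1 y x
    have h3 : m x y ≤ |ψ x y| := (hmw x y).trans (max_le (le_abs_self _) (abs_nonneg _))
    have h4 : m y x ≤ |ψ x y| := by
      rw [hψ.antisymm x y, abs_neg]
      exact (hmw y x).trans (max_le (le_abs_self _) (abs_nonneg _))
    exact abs_le.2 ⟨by linarith, by linarith⟩
  have hprop' : ∀ x y, R < dist x y → m x y - m y x = 0 := fun x y h => by
    simpa [hprop x y h] using habs x y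
  refine ⟨fun x y => m x y - m y x, ⟨fun x y => (neg_sub _ _).symm, ⟨R, hR, hprop'⟩, ?_⟩,
    fun x => ?_⟩
  · obtain ⟨K, hK, hbound⟩ := hψ.bound
    exact ⟨K, hK, fun x y => (habs x y).trans (hbound x y)⟩
  · exact (finsum_eq _ hprop' x).trans (netInflow_eq_one_of_minimal B hm x)
end

section
/- Let X be a uniformly discrete metric space of bounded geometry and f a control function. If there is C > 0 such that every finitely supported function η : X → ℝ satisfies the weighted spectral (ℓ²) inequality ∑_{x∈X} η(x)² ≤ C·∑_{x∈X} ∑_{y∈X, d(x,y)≤1} (η(x) − η(y))²·f(|(x,y)|), then X satisfies the isoperimetric inequality (I^f_∂). -/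
/-- The boundary `∂A` of a set: points at distance `≤ 1` both from `A` and from its
complement. -/
def isoBdry {X : Type*} [MetricSpace X] (A : Set X) : Set X :=
  {x | (∃ a ∈ A, dist x a ≤ 1) ∧ (∃ b ∈ Aᶜ, dist x b ≤ 1)}

/-- The isoperimetric inequality `(I^f_∂)`:  `#A ≤ C · ∑_{x ∈ ∂A} f(|x|)` for all
finite `A ⊆ X`. -/
def SatIso {X : Type*} [MetricSpace X] (e : X) (f : ℝ → ℝ) : Prop :=
  ∃ C > (0:ℝ), ∀ A : Finset X,
    (A.card : ℝ) ≤ C * ∑ᶠ x ∈ isoBdry (A : Set X), f (dist x e)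

theorem IsControlFun.exists_shift_one {f : ℝ → ℝ} (hf : IsControlFun f) :
    ∃ L > (0:ℝ), ∀ t : ℝ, 0 ≤ t → f (t + 1) ≤ L * f t := by
  obtain ⟨L, hL, h⟩ := hf.shift 1 one_pos
  refine ⟨max L (f 1), lt_max_of_lt_left hL, fun t ht => ?_⟩
  rcases ht.eq_or_lt with rfl | ht'
  · simp [hf.one_at_zero]
  · exact (h t ht').trans (mul_le_mul_of_nonneg_right (le_max_left _ _) (hf.nonneg t ht))

theorem IsControlFun.max_dist_le {X : Type*} [MetricSpace X] {f : ℝ → ℝ} (hf : IsControlFun f)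
    {L : ℝ} (hL : ∀ t : ℝ, 0 ≤ t → f (t + 1) ≤ L * f t) (e : X) {x y : X} (hxy : dist y x ≤ 1) :
    f (max (dist x e) (dist y e)) ≤ L * f (dist x e) := by
  refine (hf.mono _ _ (le_max_of_le_left dist_nonneg) (max_le ?_ ?_)).trans (hL _ dist_nonneg)
  · linarith
  · linarith [dist_triangle y x e]

theorem BddGeom.finite_isoBdry {X : Type*} [MetricSpace X] (hbg : BddGeom X) (A : Finset X) :
    (isoBdry (A : Set X)).Finite := by
  obtain ⟨N, hN⟩ := hbg 1 one_pos
  refine (A.finite_toSet.biUnion fun a _ => (hN a).1).subset ?_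
  rintro x ⟨⟨a, ha, hxa⟩, -⟩
  exact Set.mem_biUnion ha (Metric.mem_closedBall.2 hxa)

theorem mem_isoBdry_of_indicator_ne {X : Type*} [MetricSpace X] {A : Set X} {x y : X}
    (hxy : dist y x ≤ 1) (h : A.indicator (1 : X → ℝ) x ≠ A.indicator 1 y) : x ∈ isoBdry A := by
  by_cases hx : x ∈ A
  · refine ⟨⟨x, hx, by simp⟩, ⟨y, fun hy => h (by simp [hx, hy]), by rwa [dist_comm]⟩⟩
  · refine ⟨⟨y, ?_, by rwa [dist_comm]⟩, ⟨x, hx, by simp⟩⟩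
    by_contra hy
    exact h (by simp [hx, hy])

/-- A weighted spectral (ℓ²) inequality implies the
isoperimetric inequality `(I^f_∂)`. -/
theorem satIso_of_weighted_spectral_inequality
    {X : Type*} [MetricSpace X] (e : X) (f : ℝ → ℝ)
    (hud : UnifDiscrete X) (hbg : BddGeom X) (hf : IsControlFun f)
    (C : ℝ) (hC : 0 < C)
    (hspec : ∀ η : X → ℝ, (Function.support η).Finite →
      ∑ᶠ x : X, (η x) ^ 2 ≤
        C * ∑ᶠ x : X, ∑ᶠ y ∈ Metric.closedBall x 1,
          (η x - η y) ^ 2 * f (max (dist x e) (dist y e))) :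
    SatIso e f := by
  obtain ⟨L, hL, hshift⟩ := hf.exists_shift_one
  obtain ⟨N, hN⟩ := hbg 1 one_pos
  refine ⟨C * (N * L + 1), by positivity, fun A => ?_⟩
  have hB := hbg.finite_isoBdry A
  set η : X → ℝ := (A : Set X).indicator 1 with hη
  have hsupp : Function.support η ⊆ (A : Set X) := Set.support_indicator_subset
  have hcard : ∑ᶠ x : X, (η x) ^ 2 = A.card := by
    rw [finsum_eq_sum_of_support_subset (s := A) _ fun x hx => hsupp fun h => hx (by simp [h]),
      Finset.sum_congr rfl (g := fun _ => (1 : ℝ)) fun x hx => by simp [hη, hx]]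
    simp
  have hspecA := hspec η (A.finite_toSet.subset hsupp)
  have houter : Function.support (fun x => ∑ᶠ y ∈ Metric.closedBall x 1,
      (η x - η y) ^ 2 * f (max (dist x e) (dist y e))) ⊆ (hB.toFinset : Set X) := by
    intro x hx
    rw [hB.coe_toFinset]
    by_contra hxB
    refine hx (finsum_mem_eq_zero_of_forall_eq_zero fun y hy => ?_)
    have hxy : η x = η y := by
      by_contra hne
      exact hxB (mem_isoBdry_of_indicator_ne (Metric.mem_closedBall.1 hy) hne)
    simp [hxy]
  have hsq : ∀ x y, (η x - η y) ^ 2 ≤ 1 := fun x y => by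
    by_cases hx : x ∈ A <;> by_cases hy : y ∈ A <;> simp [hη, hx, hy]
  have hinner : ∀ x, ∑ᶠ y ∈ Metric.closedBall x 1,
      (η x - η y) ^ 2 * f (max (dist x e) (dist y e)) ≤ (N * L + 1) * f (dist x e) := by
    intro x
    have hfx := hf.nonneg (dist x e) dist_nonneg
    rw [finsum_mem_eq_finite_toFinset_sum _ (hN x).1]
    have hle := Finset.sum_le_card_nsmul (hN x).1.toFinset
      (fun y => (η x - η y) ^ 2 * f (max (dist x e) (dist y e))) (L * f (dist x e)) fun y hy =>
        (mul_le_of_le_one_left (hf.nonneg _ (le_max_of_le_left dist_nonneg)) (hsq x y)).trans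
          (hf.max_dist_le hshift e (by simpa using hy))
    have hNx : ((hN x).1.toFinset.card : ℝ) ≤ N := by
      rw [← Set.ncard_eq_toFinset_card _ (hN x).1]
      exact_mod_cast (hN x).2
    rw [nsmul_eq_mul] at hle
    have := mul_le_mul_of_nonneg_right hNx (mul_nonneg hL.le hfx)
    linarith
  rw [hcard, finsum_eq_sum_of_support_subset _ houter] at hspecA
  rw [finsum_mem_eq_finite_toFinset_sum _ hB, mul_assoc, Finset.mul_sum]
  exact hspecA.trans (mul_le_mul_of_nonneg_left (Finset.sum_le_sum fun x _ => hinner x) hC.le)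
end

section
/- Let X be a uniformly discrete metric space of bounded geometry, f a control function, and suppose ψ is an f-controlled 1-chain on X with ψ(x,y) = 0 whenever d(x,y) > 1 and ∂ψ(x) = 1 for all x ∈ X. Then there exists C > 0 such that every finitely supported function η : X → ℝ satisfies ∑_{x∈X} |η(x)| ≤ C·∑_{x∈X} ∑_{y∈X, d(x,y)≤1} |η(x) − η(y)|·f(|(x,y)|). -/
/-- Discrete Stokes inequality on a finite set: pairing a function with the boundary of an
antisymmetric kernel is bounded by the kernel-weighted variation of the function. -/
theorem two_mul_sum_abs_mul_boundary_le {X : Type*} (S : Finset X) (η : X → ℝ) (ψ : X → X → ℝ)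
    (hψ : ∀ x y, ψ x y = - ψ y x) :
    2 * ∑ x ∈ S, |η x| * ∑ y ∈ S, ψ y x ≤ ∑ x ∈ S, ∑ y ∈ S, |η x - η y| * |ψ x y| := by
  have hswap : ∑ x ∈ S, |η x| * ∑ y ∈ S, ψ y x = ∑ x ∈ S, ∑ y ∈ S, |η y| * ψ x y := by
    simp_rw [Finset.mul_sum]
    exact Finset.sum_comm
  have hanti : ∑ x ∈ S, |η x| * ∑ y ∈ S, ψ y x = ∑ x ∈ S, ∑ y ∈ S, -(|η x| * ψ x y) := by
    simp_rw [Finset.mul_sum]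
    refine Finset.sum_congr rfl fun x _ => Finset.sum_congr rfl fun y _ => ?_
    rw [hψ y x, mul_neg]
  rw [two_mul]
  nth_rewrite 1 [hswap]
  rw [hanti, ← Finset.sum_add_distrib]
  refine Finset.sum_le_sum fun x _ => ?_
  rw [← Finset.sum_add_distrib]
  refine Finset.sum_le_sum fun y _ => ?_
  calc |η y| * ψ x y + -(|η x| * ψ x y) = (|η y| - |η x|) * ψ x y := by ring
    _ ≤ |(|η y| - |η x|)| * |ψ x y| := (le_abs_self _).trans (abs_mul _ _).le
    _ ≤ |η x - η y| * |ψ x y| := by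
      rw [abs_sub_comm (η x)]
      exact mul_le_mul_of_nonneg_right (abs_abs_sub_abs_le _ _) (abs_nonneg _)

/-- A propagation-one `f`-controlled 1-chain bounding the
fundamental class yields the functional isoperimetric inequality `(I^f_∇)`. -/
theorem functional_inequality_of_bounding_chain
    {X : Type*} [MetricSpace X] (e : X) (f : ℝ → ℝ)
    (hud : UnifDiscrete X) (hbg : BddGeom X) (hf : IsControlFun f)
    (ψ : X → X → ℝ) (hψ : IsCtrlChain e f ψ)
    (hprop : ∀ x y : X, 1 < dist x y → ψ x y = 0)
    (hbdry : ∀ x : X, ∑ᶠ y : X, ψ y x = 1) :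
    ∃ C > (0:ℝ), ∀ η : X → ℝ, (Function.support η).Finite →
      ∑ᶠ x : X, |η x| ≤
        C * ∑ᶠ x : X, ∑ᶠ y ∈ Metric.closedBall x 1,
          |η x - η y| * f (max (dist x e) (dist y e)) := by
  classical
  obtain ⟨K, hK, hbound⟩ := hψ.bound
  obtain ⟨N, hN⟩ := hbg 1 one_pos
  have hball : ∀ x : X, (Metric.closedBall x 1).Finite := fun x => (hN x).1
  refine ⟨K, hK, fun η hη => ?_⟩
  set w : X → X → ℝ := fun x y => |η x - η y| * f (max (dist x e) (dist y e)) with hw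
  have hw_nonneg : ∀ x y, 0 ≤ w x y := fun x y =>
    mul_nonneg (abs_nonneg _) (hf.nonneg _ (le_max_of_le_left dist_nonneg))
  have hSfin : (⋃ x ∈ Function.support η, Metric.closedBall x 1).Finite :=
    hη.biUnion fun x _ => hball x
  set S : Finset X := hSfin.toFinset with hS
  have hmem : ∀ x y, η x ≠ 0 → dist y x ≤ 1 → y ∈ S := fun x y hx hy => by
    simp only [hS, Set.Finite.mem_toFinset, Set.mem_iUnion, Metric.mem_closedBall]
    exact ⟨x, hx, hy⟩
  have hleft : ∑ᶠ x, |η x| = ∑ x ∈ S, |η x| * ∑ y ∈ S, ψ y x := by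
    rw [finsum_eq_sum_of_support_subset (s := S)]
    · refine Finset.sum_congr rfl fun x _ => ?_
      by_cases hx : η x = 0
      · simp [hx]
      · rw [← finsum_eq_sum_of_support_subset (s := S), hbdry, mul_one]
        intro y hy
        by_contra hyS
        refine hy (hprop y x (not_le.mp fun h => hyS (hmem x y hx h)))
    · intro x hx
      exact hmem x x (fun h => hx (by simp [h])) (by simp)
  have hinner : ∀ x, ∑ᶠ y ∈ Metric.closedBall x 1, w x y = ∑ y ∈ (hball x).toFinset, w x y :=
    fun x => finsum_mem_eq_finite_toFinset_sum _ (hball x)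
  have hright : ∑ᶠ x, ∑ᶠ y ∈ Metric.closedBall x 1, w x y
      = ∑ x ∈ S, ∑ y ∈ (hball x).toFinset, w x y := by
    simp_rw [hinner]
    refine finsum_eq_sum_of_support_subset _ fun x hx => ?_
    by_contra hxS
    refine hx (Finset.sum_eq_zero fun y hy => ?_)
    have hxy : dist x y ≤ 1 := by simpa [dist_comm] using hy
    have hx0 : η x = 0 := by
      by_contra h
      exact hxS (hmem x x h (by simp))
    have hy0 : η y = 0 := by
      by_contra h
      exact hxS (hmem y x h hxy)
    simp [hw, hx0, hy0]
  have hpair : ∑ x ∈ S, ∑ y ∈ S, |η x - η y| * |ψ x y|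
      ≤ K * ∑ x ∈ S, ∑ y ∈ (hball x).toFinset, w x y := by
    rw [Finset.mul_sum]
    refine Finset.sum_le_sum fun x _ => ?_
    have hrestrict : ∑ y ∈ S with dist x y ≤ 1, |η x - η y| * |ψ x y|
        = ∑ y ∈ S, |η x - η y| * |ψ x y| := by
      refine Finset.sum_filter_of_ne fun y _ hne => ?_
      by_contra h
      exact hne (by simp [hprop x y (not_le.mp h)])
    rw [← hrestrict, Finset.mul_sum]
    calc ∑ y ∈ S with dist x y ≤ 1, |η x - η y| * |ψ x y|
        ≤ ∑ y ∈ S with dist x y ≤ 1, K * w x y := by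
          refine Finset.sum_le_sum fun y _ => ?_
          calc |η x - η y| * |ψ x y|
              ≤ |η x - η y| * (K * f (max (dist x e) (dist y e))) :=
                mul_le_mul_of_nonneg_left (hbound x y) (abs_nonneg _)
            _ = K * w x y := by simp only [hw]; ring
      _ ≤ ∑ y ∈ (hball x).toFinset, K * w x y := by
          refine Finset.sum_le_sum_of_subset_of_nonneg (fun y hy => ?_)
            fun y _ _ => mul_nonneg hK.le (hw_nonneg x y)
          simpa [dist_comm] using (Finset.mem_filter.mp hy).2
  have hstokes := two_mul_sum_abs_mul_boundary_le S η ψ hψ.antisymm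
  have hnonneg : 0 ≤ ∑ᶠ x, |η x| := finsum_nonneg fun x => abs_nonneg _
  rw [hright]
  rw [← hleft] at hstokes
  linarith
end
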